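/- Let a₁,…,a_L be a finite list of real numbers (viewed in WithTop ℝ) and define the two-minimum recursion f⁽⁰⁾ = s⁽⁰⁾ = ⊤ and, for ℓ = 1,…,L: f⁽ℓ⁾ = min(f⁽ℓ⁻¹⁾, a_ℓ), and s⁽ℓ⁾ = f⁽ℓ⁻¹⁾ if a_ℓ ≤ f⁽ℓ⁻¹⁾, s⁽ℓ⁾ = a_ℓ if f⁽ℓ⁻¹⁾ < a_ℓ < s⁽ℓ⁻¹⁾, and s⁽ℓ⁾ = s⁽ℓ⁻¹⁾ otherwise. Then f⁽L⁾ equals the minimum of the multiset {a₁,…,a_L} (⊤ if L = 0), and s⁽L⁾ equals the minimum of the multiset obtained from {a₁,…,a_L} by erasing one occurrence of its minimum (⊤ if L ≤ 1). That is, the global pass of the node processing algorithm correctly computes the first and second minima of its inputs. -/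

import Mathlib

/-- One step of the global pass of the two-minimum recursion: given the current pair
`(f, s)` (first and second minimum so far, in `WithTop ℝ`) and the next input `a`,
return the updated pair. -/
noncomputable def twoMinStep (p : WithTop ℝ × WithTop ℝ) (a : ℝ) : WithTop ℝ × WithTop ℝ :=
  (min p.1 (a : WithTop ℝ),
    if (a : WithTop ℝ) ≤ p.1 then p.1
    else if p.1 < (a : WithTop ℝ) ∧ (a : WithTop ℝ) < p.2 then (a : WithTop ℝ)
    else p.2)

/-- The global pass over the list of inputs `a₁, …, a_L`, starting from `f⁽⁰⁾ = s⁽⁰⁾ = ⊤`. -/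
noncomputable def twoMin (l : List ℝ) : WithTop ℝ × WithTop ℝ :=
  l.foldl twoMinStep (⊤, ⊤)

theorem Multiset.inf_erase_inf_cons {α : Type*} [LinearOrder α] [OrderTop α]
    (m : Multiset α) (a : α) :
    ((a ::ₘ m).erase (a ::ₘ m).inf).inf =
      if a ≤ m.inf then m.inf else a ⊓ (m.erase m.inf).inf := by
  rw [Multiset.inf_cons]
  split_ifs with h
  · rw [inf_eq_left.mpr h, Multiset.erase_cons_head]
  · have h' := not_le.mp h
    rw [inf_eq_right.mpr h'.le, Multiset.erase_cons_tail _ h'.ne', Multiset.inf_cons]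

theorem twoMinStep_inf (m : Multiset (WithTop ℝ)) (a : ℝ) :
    twoMinStep (m.inf, (m.erase m.inf).inf) a =
      (((a : WithTop ℝ) ::ₘ m).inf,
        (((a : WithTop ℝ) ::ₘ m).erase ((a : WithTop ℝ) ::ₘ m).inf).inf) := by
  rw [Multiset.inf_erase_inf_cons, Multiset.inf_cons, twoMinStep]
  refine Prod.ext (min_comm _ _) ?_
  dsimp only
  split_ifs with h₁ h₂
  · rfl
  · exact (inf_eq_left.mpr h₂.2.le).symm
  · exact (inf_eq_right.mpr (not_lt.mp fun h => h₂ ⟨not_le.mp h₁, h⟩)).symm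

theorem twoMin_eq (l : List ℝ) :
    twoMin l =
      ((Multiset.map ((↑) : ℝ → WithTop ℝ) l).inf,
        ((Multiset.map ((↑) : ℝ → WithTop ℝ) l).erase
          (Multiset.map ((↑) : ℝ → WithTop ℝ) l).inf).inf) := by
  induction l using List.reverseRecOn with
  | nil => simp [twoMin]
  | append_singleton l a ih =>
    have h : Multiset.map ((↑) : ℝ → WithTop ℝ) ↑(l ++ [a]) =
        (a : WithTop ℝ) ::ₘ Multiset.map ((↑) : ℝ → WithTop ℝ) l := by
      rw [← Multiset.coe_add, add_comm, Multiset.coe_singleton, Multiset.singleton_add,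
        Multiset.map_cons]
    rw [h, ← twoMinStep_inf, ← ih, twoMin, twoMin, List.foldl_append, List.foldl_cons,
      List.foldl_nil]

/-- The global pass correctly computes the first and second minima of its
inputs: `f⁽ᴸ⁾` is the minimum of the multiset `{a₁,…,a_L}` (`⊤` if `L = 0`) and `s⁽ᴸ⁾`
is the minimum of that multiset after erasing one occurrence of its minimum
(`⊤` if `L ≤ 1`). -/
theorem twoMin_correct (l : List ℝ) :
    (twoMin l).1 = ((l.map (fun x => (x : WithTop ℝ)) : Multiset (WithTop ℝ))).inf ∧
    (twoMin l).2 =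
      (((l.map (fun x => (x : WithTop ℝ)) : Multiset (WithTop ℝ))).erase
        ((l.map (fun x => (x : WithTop ℝ)) : Multiset (WithTop ℝ)).inf)).inf := by
  rw [twoMin_eq, Multiset.map_coe]
  simp only [List.map_id', List.bind_eq_flatMap, List.pure_def,
    ← List.map_eq_flatMap, and_self]
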